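/- Let (β_i)_{i≥1} be strictly positive reals. For n ≥ 1 and s ∈ (0,∞)ⁿ, let A^{(n)}(s) = diag(s₁,…,sₙ) + i·K^{(n)}, where K^{(n)}_{jk} = min(j,k), and define g_{s,n}(x) = (2π)^{−n} ∫_{ℝⁿ} exp( −⟨A^{(n)}(s)ξ, ξ⟩/2 − i⟨ξ, x⟩ ) dξ for x ∈ ℝⁿ (an absolutely convergent integral). Define the Feynman–Thomas measure μ^{(n)} as the complex measure on ℝⁿ with density ρ_n(x) = ∫_{(0,∞)ⁿ} [ Π_{i=1}^{n} (1/β_i) e^{−s_i/β_i} ] g_{s,n}(x) ds₁…dsₙ. Then ρ_n ∈ L¹(ℝⁿ), and for every n ≥ 1 the pushforward of μ^{(n+1)} under the projection (x₁,…,x_{n+1}) ↦ (x₁,…,xₙ) equals μ^{(n)}, i.e. the family (μ^{(n)})_{n≥1} is projective. -/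

import Mathlib

open MeasureTheory Matrix Set

/-- The discrete-time Brownian covariance matrix `K^{(n)}_{jk} = min(j,k)` (indices
`j,k : Fin n` standing for the indices `j+1, k+1 ∈ {1,…,n}` of the paper). -/
def Kmin (n : ℕ) : Matrix (Fin n) (Fin n) ℝ :=
  Matrix.of fun j k => ((min ((j : ℕ) + 1) ((k : ℕ) + 1) : ℕ) : ℝ)

/-- `A^{(n)}(s) = diag(s₁,…,sₙ) + i·K^{(n)}`. -/
noncomputable def Amat (n : ℕ) (s : Fin n → ℝ) : Matrix (Fin n) (Fin n) ℂ :=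
  (Matrix.diagonal s).map Complex.ofReal + Complex.I • (Kmin n).map Complex.ofReal

/-- `g_{s,n}(x) = (2π)^{−n} ∫_{ℝⁿ} exp(−⟨A^{(n)}(s)ξ,ξ⟩/2 − i⟨ξ,x⟩) dξ`. -/
noncomputable def gsn (n : ℕ) (s : Fin n → ℝ) (x : Fin n → ℝ) : ℂ :=
  (((2 * Real.pi) ^ n : ℝ)⁻¹ : ℝ) •
    ∫ ξ : Fin n → ℝ,
      Complex.exp (-(∑ j : Fin n, ∑ k : Fin n, Amat n s j k * (ξ j : ℂ) * (ξ k : ℂ)) / 2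
        - Complex.I * (∑ j : Fin n, (ξ j : ℂ) * (x j : ℂ)))

/-- The density `ρ_n(x) = ∫_{(0,∞)ⁿ} Π_i (1/β_i)e^{−s_i/β_i} · g_{s,n}(x) ds` of the
Feynman–Thomas measure `μ^{(n)}` on `ℝⁿ`. -/
noncomputable def rhoFT (β : ℕ → ℝ) (n : ℕ) (x : Fin n → ℝ) : ℂ :=
  ∫ s in Set.univ.pi (fun _ : Fin n => Ioi (0 : ℝ)),
    ((∏ i : Fin n, (β (i : ℕ))⁻¹ * Real.exp (-(s i) / β (i : ℕ)) : ℝ) : ℂ) * gsn n s x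

/-- The integrand of the oscillatory integral `gsn`. -/
noncomputable def gsnIntegrand (n : ℕ) (s x ξ : Fin n → ℝ) : ℂ :=
  Complex.exp (-(∑ j : Fin n, ∑ k : Fin n, Amat n s j k * (ξ j : ℂ) * (ξ k : ℂ)) / 2
    - Complex.I * (∑ j : Fin n, (ξ j : ℂ) * (x j : ℂ)))

theorem norm_gsnIntegrand (n : ℕ) (s ξ x : Fin n → ℝ) :
    ‖Complex.exp (-(∑ j : Fin n, ∑ k : Fin n, Amat n s j k * (ξ j : ℂ) * (ξ k : ℂ)) / 2
        - Complex.I * (∑ j : Fin n, (ξ j : ℂ) * (x j : ℂ)))‖ =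
      ∏ i, Real.exp (-(s i / 2) * ξ i ^ 2) := by
  have hA : ∀ j k, (Amat n s j k * (ξ j : ℂ) * (ξ k : ℂ)).re
      = if j = k then s j * ξ j * ξ k else 0 := by
    intro j k
    rw [mul_assoc, ← Complex.ofReal_mul, Complex.re_mul_ofReal]
    simp only [Amat, Matrix.add_apply, Matrix.map_apply, Matrix.smul_apply, Matrix.diagonal_apply,
      smul_eq_mul]
    split_ifs <;> simp [mul_assoc]
  rw [Complex.norm_exp, ← Real.exp_sum]
  congr 1
  rw [Complex.sub_re, Complex.div_ofNat_re, Complex.neg_re, Complex.re_sum]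
  simp_rw [Complex.re_sum, hA]
  simp only [Finset.sum_ite_eq, Finset.mem_univ, if_true]
  have : (∑ j : Fin n, (ξ j : ℂ) * (x j : ℂ)) = ((∑ j, ξ j * x j : ℝ) : ℂ) := by push_cast; rfl
  rw [this, Complex.re_mul_ofReal, Complex.I_re, zero_mul, sub_zero, ← Finset.sum_neg_distrib,
    Finset.sum_div]
  exact Finset.sum_congr rfl fun i _ => by ring

theorem integrable_prod_gaussian {ι : Type*} [Fintype ι] {b : ι → ℝ} (hb : ∀ i, 0 < b i) :
    Integrable fun ξ : ι → ℝ => ∏ i, Real.exp (-(b i) * ξ i ^ 2) :=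
  Integrable.fintype_prod (f := fun i (v : ℝ) => Real.exp (-(b i) * v ^ 2))
    fun i => integrable_exp_neg_mul_sq (hb i)

theorem integrable_gsnIntegrand (n : ℕ) {s : Fin n → ℝ} (hs : ∀ i, 0 < s i) (x : Fin n → ℝ) :
    Integrable (fun ξ : Fin n → ℝ =>
        Complex.exp (-(∑ j : Fin n, ∑ k : Fin n, Amat n s j k * (ξ j : ℂ) * (ξ k : ℂ)) / 2
          - Complex.I * (∑ j : Fin n, (ξ j : ℂ) * (x j : ℂ)))) := by
  refine (integrable_prod_gaussian fun i => half_pos (hs i)).mono'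
    (by fun_prop) (ae_of_all _ fun ξ => (norm_gsnIntegrand n s ξ x).le)

theorem stronglyMeasurable_gsn (n : ℕ) :
    StronglyMeasurable fun p : (Fin n → ℝ) × (Fin n → ℝ) => gsn n p.1 p.2 := by
  unfold gsn
  refine StronglyMeasurable.const_smul (𝕜 := ℝ) ?_ _
  refine StronglyMeasurable.integral_prod_right (ν := volume)
    (f := fun (p : (Fin n → ℝ) × (Fin n → ℝ)) (ξ : Fin n → ℝ) =>
      Complex.exp (-(∑ j : Fin n, ∑ k : Fin n, Amat n p.1 j k * (ξ j : ℂ) * (ξ k : ℂ)) / 2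
        - Complex.I * (∑ j : Fin n, (ξ j : ℂ) * (p.2 j : ℂ)))) ?_
  refine Continuous.stronglyMeasurable ?_
  have : ∀ j k, Continuous fun s : Fin n → ℝ => Amat n s j k := by
    intro j k
    simp only [Amat, Matrix.add_apply, Matrix.map_apply, Matrix.smul_apply, Matrix.diagonal_apply]
    split_ifs <;> fun_prop
  have h2 : ∀ j k, Continuous fun p : ((Fin n → ℝ) × (Fin n → ℝ)) × (Fin n → ℝ) =>
      Amat n p.1.1 j k := fun j k => (this j k).comp (continuous_fst.comp continuous_fst)
  simp only [Function.uncurry_def]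
  fun_prop

theorem exists_congr_diagonal {n : ℕ} {s : Fin n → ℝ} (hs : ∀ i, 0 < s i)
    {K : Matrix (Fin n) (Fin n) ℝ} (hK : K.IsHermitian) :
    ∃ (P : Matrix (Fin n) (Fin n) ℝ) (l : Fin n → ℝ),
      Pᵀ * diagonal s * P = 1 ∧ Pᵀ * K * P = diagonal l := by
  set R : Matrix (Fin n) (Fin n) ℝ := diagonal fun i => (√(s i))⁻¹ with hR
  have hRT : Rᵀ = R := diagonal_transpose _
  have hM : (R * K * R).IsHermitian := by
    have := isHermitian_conjTranspose_mul_mul R hK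
    rwa [conjTranspose_eq_transpose_of_trivial, hRT] at this
  set U : Matrix (Fin n) (Fin n) ℝ := (hM.eigenvectorUnitary : Matrix (Fin n) (Fin n) ℝ)
  have hUU : Uᵀ * U = 1 := by
    have := Unitary.coe_star_mul_self hM.eigenvectorUnitary
    rwa [star_eq_conjTranspose, conjTranspose_eq_transpose_of_trivial] at this
  refine ⟨R * U, hM.eigenvalues, ?_, ?_⟩
  · have : R * diagonal s * R = 1 := by
      rw [hR, diagonal_mul_diagonal, diagonal_mul_diagonal, ← diagonal_one]
      congr 1
      funext i
      have h := Real.sq_sqrt (hs i).le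
      have h0 := (Real.sqrt_pos.2 (hs i)).ne'
      field_simp
      exact h.symm
    rw [transpose_mul, hRT]
    calc Uᵀ * R * diagonal s * (R * U) = Uᵀ * (R * diagonal s * R) * U := by
          simp only [Matrix.mul_assoc]
      _ = 1 := by rw [this, Matrix.mul_one, hUU]
  · have := hM.conjStarAlgAut_star_eigenvectorUnitary
    rw [Unitary.conjStarAlgAut_star_apply] at this
    rw [star_eq_conjTranspose, conjTranspose_eq_transpose_of_trivial] at this
    rw [transpose_mul, hRT]
    calc Uᵀ * R * K * (R * U) = Uᵀ * (R * K * R) * U := by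
          simp only [Matrix.mul_assoc]
      _ = _ := this

theorem sum_mul_mulVec {ι : Type*} [Fintype ι] [DecidableEq ι] {A : Matrix ι ι ℂ}
    {P : Matrix ι ι ℝ} {d : ι → ℂ}
    (h : (P.map Complex.ofReal)ᵀ * A * P.map Complex.ofReal = diagonal d) (ζ : ι → ℝ) :
    ∑ j, ∑ k, A j k * ((P *ᵥ ζ) j : ℂ) * ((P *ᵥ ζ) k : ℂ) = ∑ i, d i * (ζ i : ℂ) ^ 2 := by
  set z : ι → ℂ := fun i => (ζ i : ℂ)
  have hv : (fun j => (((P *ᵥ ζ) j : ℝ) : ℂ)) = P.map Complex.ofReal *ᵥ z := by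
    funext j
    simp [mulVec, dotProduct, z]
  have h1 : ∑ j, ∑ k, A j k * ((P *ᵥ ζ) j : ℂ) * ((P *ᵥ ζ) k : ℂ) =
      (P.map Complex.ofReal *ᵥ z) ⬝ᵥ (A *ᵥ (P.map Complex.ofReal *ᵥ z)) := by
    rw [← hv]
    simp only [dotProduct, mulVec, Finset.mul_sum]
    exact Finset.sum_congr rfl fun j _ => Finset.sum_congr rfl fun k _ => by ring
  rw [h1, dotProduct_comm, ← dotProduct_transpose_mulVec, mulVec_mulVec, mulVec_mulVec,
    h, dotProduct_comm]
  simp only [dotProduct, mulVec_diagonal, z]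
  exact Finset.sum_congr rfl fun j _ => by ring

theorem integral_eq_abs_det_mul_integral_comp_mulVec {ι E : Type*} [Fintype ι] [DecidableEq ι]
    [NormedAddCommGroup E] [NormedSpace ℝ E] {P : Matrix ι ι ℝ} (hP : P.det ≠ 0)
    {f : (ι → ℝ) → E} (hf : Continuous f) :
    ∫ x, f x = |P.det| • ∫ x, f (P *ᵥ x) := by
  have hm : Measurable (toLin' P) := (LinearMap.continuous_of_finiteDimensional _).measurable
  have h := integral_map hm.aemeasurable (μ := volume) (f := f)
    (by
      rw [Real.map_matrix_volume_pi_eq_smul_volume_pi hP]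
      exact hf.aestronglyMeasurable)
  rw [Real.map_matrix_volume_pi_eq_smul_volume_pi hP, integral_smul_measure,
    ENNReal.toReal_ofReal (abs_nonneg _)] at h
  simp only [toLin'_apply] at h
  rw [← h, smul_smul, ← abs_mul, mul_inv_cancel₀ hP, abs_one, one_smul]

theorem integrable_comp_mulVec {ι E : Type*} [Fintype ι] [DecidableEq ι]
    [NormedAddCommGroup E] {P : Matrix ι ι ℝ} (hP : P.det ≠ 0)
    {f : (ι → ℝ) → E} (hf : Integrable f) : Integrable fun x => f (P *ᵥ x) := by
  have hm : Measurable (toLin' P) := (LinearMap.continuous_of_finiteDimensional _).measurable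
  have h : Integrable f (Measure.map (toLin' P) volume) := by
    rw [Real.map_matrix_volume_pi_eq_smul_volume_pi hP]
    exact hf.smul_measure ENNReal.ofReal_ne_top
  exact h.comp_measurable hm

theorem map_transpose_mul_Amat_mul_map {n : ℕ} {s l : Fin n → ℝ} {P : Matrix (Fin n) (Fin n) ℝ}
    (h1 : Pᵀ * diagonal s * P = 1) (h2 : Pᵀ * Kmin n * P = diagonal l) :
    (P.map Complex.ofReal)ᵀ * Amat n s * P.map Complex.ofReal =
      diagonal fun i => 1 + (l i : ℂ) * Complex.I := by
  have key : ∀ M : Matrix (Fin n) (Fin n) ℝ,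
      (P.map Complex.ofReal)ᵀ * M.map Complex.ofReal * P.map Complex.ofReal =
        (Pᵀ * M * P).map Complex.ofReal := by
    intro M
    have hmul : ∀ M N : Matrix (Fin n) (Fin n) ℝ, (M * N).map Complex.ofReal =
        M.map Complex.ofReal * N.map Complex.ofReal :=
      fun M N => Matrix.map_mul (f := Complex.ofRealHom)
    rw [hmul, hmul, transpose_map]
  rw [Amat, Matrix.mul_add, Matrix.add_mul, Matrix.mul_smul, Matrix.smul_mul, key, key, h1, h2]
  ext i j
  by_cases hij : i = j
  · subst hij; simp [mul_comm]
  · simp [hij]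

theorem norm_gsn {n : ℕ} {s l : Fin n → ℝ} {P : Matrix (Fin n) (Fin n) ℝ}
    (h1 : Pᵀ * diagonal s * P = 1) (h2 : Pᵀ * Kmin n * P = diagonal l) (x : Fin n → ℝ) :
    ‖gsn n s x‖ = ((2 * Real.pi) ^ n)⁻¹ * |P.det| * ∏ i, √(2 * Real.pi / √(1 + l i ^ 2)) *
      Real.exp (-(1 / (2 * (1 + l i ^ 2))) * (Pᵀ *ᵥ x) i ^ 2) := by
  have hP : P.det ≠ 0 := by
    intro h0
    have := congrArg Matrix.det h1
    simp [det_mul, h0] at this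
  set d : Fin n → ℂ := fun i => 1 + (l i : ℂ) * Complex.I with hd
  have hdn : ∀ i, ‖d i‖ = √(1 + l i ^ 2) := by
    intro i
    have := Complex.norm_add_mul_I 1 (l i)
    simpa [hd] using this
  have hd0 : ∀ i, d i ≠ 0 := by
    intro i h
    have := congrArg Complex.re h
    simp [hd] at this
  have hy : ∀ ζ : Fin n → ℝ, ∑ j, ((P *ᵥ ζ) j : ℂ) * (x j : ℂ) =
      ∑ i, ((Pᵀ *ᵥ x) i : ℂ) * (ζ i : ℂ) := by
    intro ζ
    have : (P *ᵥ ζ) ⬝ᵥ x = (Pᵀ *ᵥ x) ⬝ᵥ ζ := by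
      rw [mulVec_transpose, ← dotProduct_mulVec, dotProduct_comm]
    have := congrArg Complex.ofReal this
    simpa [dotProduct] using this
  have hint : ∫ ξ : Fin n → ℝ,
      Complex.exp (-(∑ j : Fin n, ∑ k : Fin n, Amat n s j k * (ξ j : ℂ) * (ξ k : ℂ)) / 2
        - Complex.I * (∑ j : Fin n, (ξ j : ℂ) * (x j : ℂ))) =
      |P.det| • ∏ i, (Real.pi / (d i / 2)) ^ (1 / 2 : ℂ) *
        Complex.exp ((-Complex.I * ((Pᵀ *ᵥ x) i : ℂ)) ^ 2 / (4 * (d i / 2))) := by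
    rw [integral_eq_abs_det_mul_integral_comp_mulVec hP (by fun_prop),
      ← GaussianFourier.integral_cexp_neg_sum_mul_add (fun i => by simp [hd])]
    congr 1
    refine integral_congr_ae (ae_of_all _ fun ζ => ?_)
    simp only
    rw [sum_mul_mulVec (map_transpose_mul_Amat_mul_map h1 h2), hy]
    congr 1
    rw [sub_eq_add_neg, ← neg_mul, Finset.mul_sum, neg_div, Finset.sum_div]
    congr 2
    · exact Finset.sum_congr rfl fun i _ => by simp only [hd]; ring
    · exact funext fun i => by ring
  rw [gsn, hint, norm_smul, norm_smul, Real.norm_eq_abs, Real.norm_eq_abs, abs_abs,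
    abs_of_nonneg (by positivity), norm_prod, mul_assoc]
  congr 2
  refine Finset.prod_congr rfl fun i _ => ?_
  rw [norm_mul]
  congr 1
  · have : (1 / 2 : ℂ) = ((1 / 2 : ℝ) : ℂ) := by push_cast; rfl
    rw [this, Complex.norm_cpow_real, Real.sqrt_eq_rpow (2 * Real.pi / _), norm_div, norm_div, hdn]
    congr 1
    rw [Complex.norm_real, Real.norm_of_nonneg Real.pi_pos.le, Complex.norm_ofNat]
    field_simp
  · rw [Complex.norm_exp]
    congr 1
    have e : (-Complex.I * ((Pᵀ *ᵥ x) i : ℂ)) ^ 2 / (4 * (d i / 2)) =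
        ((-((Pᵀ *ᵥ x) i ^ 2 / 2) : ℝ) : ℂ) * (d i)⁻¹ := by
      have := hd0 i
      push_cast
      rw [mul_pow, neg_sq, Complex.I_sq]
      field_simp
      ring
    rw [e, Complex.re_ofReal_mul, Complex.inv_re, Complex.normSq_eq_norm_sq, hdn,
      Real.sq_sqrt (by positivity)]
    simp only [hd, Complex.add_re, Complex.one_re, Complex.re_ofReal_mul, Complex.I_re, mul_zero,
      add_zero]
    have : (1 + l i ^ 2) ≠ 0 := by positivity
    field_simp

theorem norm_det_Amat_le {n : ℕ} {s : Fin n → ℝ} (hs : ∀ i, 0 < s i) :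
    ‖(Amat n s).det‖ ≤ n.factorial * ∏ i, (s i + n) := by
  have hA : ∀ j k, ‖Amat n s j k‖ ≤ s k + n := by
    intro j k
    rw [Amat, Matrix.add_apply]
    refine (norm_add_le _ _).trans (add_le_add ?_ ?_)
    · rw [map_apply, diagonal_apply, Complex.norm_real]
      split_ifs with h
      · rw [h, Real.norm_of_nonneg (hs k).le]
      · simpa using (hs k).le
    · rw [Matrix.smul_apply, map_apply, smul_eq_mul, norm_mul, Complex.norm_I, one_mul,
        Complex.norm_real, Kmin, of_apply, Real.norm_of_nonneg (Nat.cast_nonneg _)]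
      exact_mod_cast (min_le_left _ _).trans j.2
  rw [det_apply]
  refine (norm_sum_le _ _).trans ?_
  refine (Finset.sum_le_card_nsmul _ _ (∏ i, (s i + n)) fun σ _ => ?_).trans ?_
  · rw [Units.smul_def, zsmul_eq_mul, norm_mul, norm_prod]
    have : ‖((Equiv.Perm.sign σ : ℤ) : ℂ)‖ = 1 := by
      rcases Int.units_eq_one_or (Equiv.Perm.sign σ) with h | h <;> simp [h]
    rw [this, one_mul]
    exact Finset.prod_le_prod (fun _ _ => norm_nonneg _) fun i _ => hA _ _
  · rw [Finset.card_univ, Fintype.card_perm, Fintype.card_fin, nsmul_eq_mul]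

theorem integrable_gsn_and_integral_norm_le {n : ℕ} {s : Fin n → ℝ} (hs : ∀ i, 0 < s i) :
    Integrable (gsn n s) ∧ ∫ x, ‖gsn n s x‖ ≤ √n.factorial * ∏ i, √(1 + n / s i) := by
  have hK : (Kmin n).IsHermitian := by
    ext i j
    simp [Kmin, min_comm]
  obtain ⟨P, l, h1, h2⟩ := exists_congr_diagonal hs hK
  have hdet : P.det ^ 2 * ∏ i, s i = 1 := by
    have := congrArg Matrix.det h1
    rw [det_mul, det_mul, det_transpose, det_diagonal, det_one] at this
    linarith
  have hP : P.det ≠ 0 := by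
    rintro h0
    simp [h0] at hdet
  have hPT : (Pᵀ).det ≠ 0 := by rwa [det_transpose]
  have hs0 : 0 < ∏ i, s i := Finset.prod_pos fun i _ => hs i
  set b : Fin n → ℝ := fun i => 1 / (2 * (1 + l i ^ 2)) with hb
  have hb0 : ∀ i, 0 < b i := fun i => by positivity
  set f : (Fin n → ℝ) → ℝ := fun y => ∏ i, √(2 * Real.pi / √(1 + l i ^ 2)) *
      Real.exp (-(b i) * y i ^ 2) with hf
  have hnorm : ∀ x, ‖gsn n s x‖ = ((2 * Real.pi) ^ n)⁻¹ * |P.det| * f (Pᵀ *ᵥ x) :=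
    fun x => norm_gsn h1 h2 x
  have hfint : Integrable f := by
    simp only [hf, Finset.prod_mul_distrib]
    exact (integrable_prod_gaussian hb0).const_mul _
  have hfval : ∫ y, f y = ∏ i, (2 * Real.pi * √√(1 + l i ^ 2)) := by
    rw [hf, integral_fintype_prod_volume_eq_prod
      (f := fun i (y : ℝ) => √(2 * Real.pi / √(1 + l i ^ 2)) * Real.exp (-(b i) * y ^ 2))]
    refine Finset.prod_congr rfl fun i _ => ?_
    rw [integral_const_mul, integral_gaussian, ← Real.sqrt_mul (by positivity)]
    set r := √(1 + l i ^ 2) with hr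
    have hr0 : 0 < r := Real.sqrt_pos.2 (by positivity)
    have hr2 : 1 + l i ^ 2 = r ^ 2 := (Real.sq_sqrt (by positivity)).symm
    have : 2 * Real.pi / r * (Real.pi / b i) = (2 * Real.pi) ^ 2 * r := by
      simp only [hb, hr2]
      field_simp
    rw [this, Real.sqrt_mul (by positivity), Real.sqrt_sq (by positivity)]
  have hfc : Continuous f := by fun_prop
  refine ⟨?_, ?_⟩
  · have hm : StronglyMeasurable (gsn n s) :=
      (stronglyMeasurable_gsn n).comp_measurable (g := fun x => (s, x)) (by fun_prop)
    refine ((integrable_comp_mulVec hPT hfint).const_mul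
      (((2 * Real.pi) ^ n)⁻¹ * |P.det|)).mono' hm.aestronglyMeasurable
      (ae_of_all _ fun x => (hnorm x).le)
  · have hval := integral_eq_abs_det_mul_integral_comp_mulVec hPT hfc
    rw [det_transpose, smul_eq_mul] at hval
    simp_rw [hnorm]
    rw [integral_const_mul, mul_assoc, ← hval, hfval, Finset.prod_mul_distrib, Finset.prod_const,
      Finset.card_univ, Fintype.card_fin, inv_mul_cancel_left₀ (by positivity),
      ← Real.sqrt_prod _ (fun i _ => Real.sqrt_nonneg _)]
    have hprod : ∏ i, √(1 + l i ^ 2) = ‖(Amat n s).det‖ / ∏ i, s i := by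
      have := congrArg (fun M => ‖Matrix.det M‖) (map_transpose_mul_Amat_mul_map h1 h2)
      simp only [det_mul, det_transpose, det_diagonal, norm_mul, norm_prod] at this
      have hPd : ‖(P.map Complex.ofReal).det‖ = |P.det| := by
        have h := RingHom.map_det Complex.ofRealHom P
        have h' : (P.map Complex.ofReal).det = (P.det : ℂ) := h.symm
        rw [h', Complex.norm_real, Real.norm_eq_abs]
      have hl : ∀ i, ‖1 + (l i : ℂ) * Complex.I‖ = √(1 + l i ^ 2) := by
        intro i
        have := Complex.norm_add_mul_I 1 (l i)
        simpa using this
      simp only [hl, hPd] at this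
      rw [← this, eq_div_iff hs0.ne']
      linear_combination ‖(Amat n s).det‖ * hdet +
        ‖(Amat n s).det‖ * (∏ i, s i) * sq_abs P.det
    rw [hprod, ← Real.sqrt_prod _ (fun i _ => by have := hs i; positivity),
      ← Real.sqrt_mul (by positivity)]
    refine Real.sqrt_le_sqrt ?_
    rw [div_le_iff₀ hs0, mul_assoc, ← Finset.prod_mul_distrib]
    refine (norm_det_Amat_le hs).trans_eq ?_
    congr 1
    refine Finset.prod_congr rfl fun i _ => ?_
    have := (hs i).ne'
    field_simp

theorem integrableOn_exp_mul_sqrt {b : ℝ} (hb : 0 < b) {c : ℝ} (hc : 0 ≤ c) :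
    IntegrableOn (fun t : ℝ => b⁻¹ * Real.exp (-t / b) * √(1 + c / t)) (Ioi 0) := by
  have h1 := integrableOn_rpow_mul_exp_neg_mul_rpow (s := 0) (p := 1) (b := b⁻¹)
    (by norm_num) one_pos (inv_pos.2 hb)
  have h2 := integrableOn_rpow_mul_exp_neg_mul_rpow (s := -(1 / 2)) (p := 1) (b := b⁻¹)
    (by norm_num) one_pos (inv_pos.2 hb)
  refine Integrable.mono' ((h1.const_mul b⁻¹).add (h2.const_mul (b⁻¹ * √c)))
    (by fun_prop) ?_
  refine (ae_restrict_iff' measurableSet_Ioi).2 (ae_of_all _ fun t (ht : 0 < t) => ?_)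
  have hsq : √(1 + c / t) ≤ 1 + √c * t ^ (-(1 / 2) : ℝ) := by
    have : √c * t ^ (-(1 / 2) : ℝ) = √(c / t) := by
      rw [Real.rpow_neg ht.le, ← Real.sqrt_eq_rpow, Real.sqrt_div hc, div_eq_mul_inv]
    rw [this]
    refine Real.sqrt_le_iff.2 ⟨by positivity, ?_⟩
    have := Real.sq_sqrt (show 0 ≤ c / t by positivity)
    nlinarith [Real.sqrt_nonneg (c / t)]
  have he : Real.exp (-b⁻¹ * t ^ (1 : ℝ)) = Real.exp (-t / b) := by
    rw [Real.rpow_one]; congr 1; field_simp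
  rw [Real.norm_of_nonneg (by positivity)]
  simp only [Pi.add_apply, he, Real.rpow_zero, one_mul]
  calc _ ≤ b⁻¹ * Real.exp (-t / b) * (1 + √c * t ^ (-(1 / 2) : ℝ)) := by gcongr
    _ = _ := by ring

theorem measurePreserving_snoc {n : ℕ} (μ : Measure ℝ) [SigmaFinite μ] :
    MeasurePreserving (fun p : (Fin n → ℝ) × ℝ => (Fin.snoc p.1 p.2 : Fin (n + 1) → ℝ))
      ((Measure.pi fun _ => μ).prod μ) (Measure.pi fun _ => μ) := by
  have h := (measurePreserving_piFinSuccAbove (fun _ : Fin (n + 1) => μ) (Fin.last n)).symm.comp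
    (Measure.measurePreserving_swap (μ := Measure.pi fun _ : Fin n => μ) (ν := μ))
  convert! h using 1
  funext p
  exact (Fin.insertNth_last' p.2 p.1).symm

theorem measurableEmbedding_snoc {n : ℕ} :
    MeasurableEmbedding fun p : (Fin n → ℝ) × ℝ => (Fin.snoc p.1 p.2 : Fin (n + 1) → ℝ) := by
  convert! (MeasurableEquiv.prodComm.trans
    (MeasurableEquiv.piFinSuccAbove (fun _ : Fin (n + 1) => ℝ) (Fin.last n)).symm).measurableEmbedding
    using 1
  funext p
  exact (Fin.insertNth_last' p.2 p.1).symm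

theorem integral_snoc {n : ℕ} {E : Type*} [NormedAddCommGroup E] [NormedSpace ℝ E] (μ : Measure ℝ)
    [SigmaFinite μ] (f : (Fin (n + 1) → ℝ) → E) :
    ∫ p : (Fin n → ℝ) × ℝ, f (Fin.snoc p.1 p.2) ∂((Measure.pi fun _ => μ).prod μ) =
      ∫ y, f y ∂(Measure.pi fun _ => μ) :=
  (measurePreserving_snoc μ).integral_comp measurableEmbedding_snoc f

theorem integral_snoc_volume {n : ℕ} {E : Type*} [NormedAddCommGroup E] [NormedSpace ℝ E]
    (f : (Fin (n + 1) → ℝ) → E) :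
    ∫ p : (Fin n → ℝ) × ℝ, f (Fin.snoc p.1 p.2) = ∫ y, f y :=
  integral_snoc volume f

theorem integrable_snoc {n : ℕ} {E : Type*} [NormedAddCommGroup E] {f : (Fin (n + 1) → ℝ) → E}
    (hf : Integrable f) : Integrable fun p : (Fin n → ℝ) × ℝ => f (Fin.snoc p.1 p.2) :=
  ((measurePreserving_snoc volume).integrable_comp_emb measurableEmbedding_snoc).2 hf

theorem Amat_castSucc (n : ℕ) (s : Fin (n + 1) → ℝ) (j k : Fin n) :
    Amat (n + 1) s j.castSucc k.castSucc = Amat n (fun i => s i.castSucc) j k := by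
  simp [Amat, Kmin, diagonal_apply]

theorem gsnIntegrand_snoc (n : ℕ) (s : Fin (n + 1) → ℝ) (x ξ : Fin n → ℝ) (t τ : ℝ) :
    gsnIntegrand (n + 1) s (Fin.snoc x t) (Fin.snoc ξ τ) =
      Complex.exp (((-τ * t : ℝ) : ℂ) * Complex.I) *
        gsnIntegrand (n + 1) s (Fin.snoc x 0) (Fin.snoc ξ τ) := by
  rw [gsnIntegrand, gsnIntegrand, ← Complex.exp_add]
  congr 1
  rw [Fin.sum_univ_castSucc (f := fun j => ((Fin.snoc ξ τ : Fin (n + 1) → ℝ) j : ℂ) *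
      ((Fin.snoc x t : Fin (n + 1) → ℝ) j : ℂ)),
    Fin.sum_univ_castSucc (f := fun j => ((Fin.snoc ξ τ : Fin (n + 1) → ℝ) j : ℂ) *
      ((Fin.snoc x 0 : Fin (n + 1) → ℝ) j : ℂ))]
  simp only [Fin.snoc_castSucc, Fin.snoc_last]
  push_cast
  ring

theorem gsnIntegrand_snoc_zero (n : ℕ) (s : Fin (n + 1) → ℝ) (x ξ : Fin n → ℝ) :
    gsnIntegrand (n + 1) s (Fin.snoc x 0) (Fin.snoc ξ 0) =
      gsnIntegrand n (fun i => s i.castSucc) x ξ := by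
  simp only [gsnIntegrand, Fin.sum_univ_castSucc, Fin.snoc_castSucc, Fin.snoc_last, Amat_castSucc]
  simp

theorem continuous_snoc {n : ℕ} :
    Continuous fun p : (Fin n → ℝ) × ℝ => (Fin.snoc p.1 p.2 : Fin (n + 1) → ℝ) :=
  Continuous.finSnoc (A := fun _ => ℝ) continuous_fst continuous_snd

theorem continuous_gsnIntegrand (n : ℕ) (s x : Fin n → ℝ) : Continuous (gsnIntegrand n s x) := by
  unfold gsnIntegrand
  fun_prop

open FourierTransform in
theorem integral_gsn_snoc {n : ℕ} {s : Fin (n + 1) → ℝ} (hs : ∀ i, 0 < s i) (x : Fin n → ℝ)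
    (hx : Integrable fun t : ℝ => gsn (n + 1) s (Fin.snoc x t)) :
    ∫ t : ℝ, gsn (n + 1) s (Fin.snoc x t) = gsn n (fun i => s i.castSucc) x := by
  set F : ℝ → ℂ := fun τ => ∫ ξ : Fin n → ℝ,
    gsnIntegrand (n + 1) s (Fin.snoc x 0) (Fin.snoc ξ τ) with hF
  have hint : ∀ t, Integrable fun p : (Fin n → ℝ) × ℝ =>
      gsnIntegrand (n + 1) s (Fin.snoc x t) (Fin.snoc p.1 p.2) := fun t =>
    integrable_snoc (integrable_gsnIntegrand (n + 1) hs (Fin.snoc x t))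
  have hFint : Integrable F := (hint 0).integral_prod_right
  have hFc : Continuous F := by
    refine continuous_of_dominated
      (bound := fun ξ => ∏ i : Fin n, Real.exp (-(s i.castSucc / 2) * ξ i ^ 2)) ?_ ?_ ?_ ?_
    · exact fun τ => ((continuous_gsnIntegrand _ _ _).comp
        (continuous_snoc.comp (by fun_prop : Continuous fun ξ : Fin n → ℝ => (ξ, τ)))
        ).aestronglyMeasurable
    · refine fun τ => ae_of_all _ fun ξ => ?_
      rw [gsnIntegrand, norm_gsnIntegrand, Fin.prod_univ_castSucc]
      simp only [Fin.snoc_castSucc, Fin.snoc_last]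
      refine mul_le_of_le_one_right (by positivity) (Real.exp_le_one_iff.2 ?_)
      nlinarith [hs (Fin.last n), sq_nonneg τ]
    · exact integrable_prod_gaussian fun i => half_pos (hs _)
    · exact ae_of_all _ fun ξ => (continuous_gsnIntegrand _ _ _).comp
        (continuous_snoc.comp (by fun_prop : Continuous fun τ : ℝ => (ξ, τ)))
  have hg : ∀ t, ((2 * Real.pi) ^ (n + 1) : ℝ) • gsn (n + 1) s (Fin.snoc x t) =
      ∫ τ : ℝ, Complex.exp (((-τ * t : ℝ) : ℂ) * Complex.I) * F τ := by
    intro t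
    have h0 : gsn (n + 1) s (Fin.snoc x t) = (((2 * Real.pi) ^ (n + 1) : ℝ)⁻¹ : ℝ) •
      ∫ ξ, gsnIntegrand (n + 1) s (Fin.snoc x t) ξ := rfl
    rw [h0, smul_inv_smul₀ (by positivity), ← integral_snoc_volume, Measure.volume_eq_prod,
      integral_prod_symm _ (hint t)]
    simp_rw [gsnIntegrand_snoc n s x _ t, integral_const_mul]
    rfl
  have hFF : ∀ w, 𝓕 F w =
      ((2 * Real.pi) ^ (n + 1) : ℝ) • gsn (n + 1) s (Fin.snoc x ((2 * Real.pi) * w)) := by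
    intro w
    rw [hg, Real.fourier_real_eq_integral_exp_smul]
    refine integral_congr_ae (ae_of_all _ fun v => ?_)
    simp only [smul_eq_mul]
    congr 4
    ring
  have hFF' : 𝓕 F = fun w =>
      ((2 * Real.pi) ^ (n + 1) : ℝ) • gsn (n + 1) s (Fin.snoc x ((2 * Real.pi) * w)) := funext hFF
  have hFFint : Integrable (𝓕 F) := by
    rw [hFF']
    exact (hx.comp_mul_left' (R := 2 * Real.pi) (by positivity)).smul
      ((2 * Real.pi) ^ (n + 1) : ℝ)
  have hinv := congrFun (hFc.fourierInv_fourier_eq hFint hFFint) 0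
  rw [Real.fourierInv_eq'] at hinv
  simp only [inner_zero_right, mul_zero, Complex.ofReal_zero, zero_mul, Complex.exp_zero,
    one_smul, hFF] at hinv
  rw [integral_smul, Measure.integral_comp_mul_left
    (fun t => gsn (n + 1) s (Fin.snoc x t)), smul_smul, abs_inv, abs_of_pos (by positivity),
    pow_succ, mul_inv_cancel_right₀ (by positivity)] at hinv
  have hF0 : F 0 = ((2 * Real.pi) ^ n : ℝ) • gsn n (fun i => s i.castSucc) x := by
    have h0 : gsn n (fun i => s i.castSucc) x = (((2 * Real.pi) ^ n : ℝ)⁻¹ : ℝ) •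
      ∫ ξ, gsnIntegrand n (fun i => s i.castSucc) x ξ := rfl
    rw [h0, smul_inv_smul₀ (by positivity)]
    simp_rw [hF, gsnIntegrand_snoc_zero]
  rw [hF0] at hinv
  exact smul_right_injective ℂ (show ((2 * Real.pi) ^ n : ℝ) ≠ 0 by positivity) hinv

theorem setIntegral_gsn_preimage {n : ℕ} {s : Fin (n + 1) → ℝ} (hs : ∀ i, 0 < s i)
    {E : Set (Fin n → ℝ)} (hE : MeasurableSet E) :
    ∫ x in (fun (x : Fin (n + 1) → ℝ) (i : Fin n) => x i.castSucc) ⁻¹' E, gsn (n + 1) s x =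
      ∫ x in E, gsn n (fun i => s i.castSucc) x := by
  have hmeas : Measurable fun (x : Fin (n + 1) → ℝ) (i : Fin n) => x i.castSucc := by fun_prop
  have hint := integrable_snoc (integrable_gsn_and_integral_norm_le hs).1
  rw [← integral_indicator (hmeas hE), ← integral_indicator hE, ← integral_snoc_volume, Measure.volume_eq_prod,
    integral_prod _ (integrable_snoc
      ((integrable_gsn_and_integral_norm_le hs).1.indicator (hmeas hE)))]
  refine integral_congr_ae ?_
  filter_upwards [hint.prod_right_ae] with x hx
  have hpre : ∀ t : ℝ, (Fin.snoc x t : Fin (n + 1) → ℝ) ∈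
      (fun (x : Fin (n + 1) → ℝ) (i : Fin n) => x i.castSucc) ⁻¹' E ↔ x ∈ E := by
    intro t
    simp only [mem_preimage, Fin.snoc_castSucc]
  by_cases hxE : x ∈ E
  · simp only [indicator, hpre, hxE, if_true]
    exact integral_gsn_snoc hs x hx
  · simp only [indicator, hpre, hxE, if_false, integral_zero]

/-- The product exponential density in the definition of `rhoFT`. -/
noncomputable def expWeight (β : ℕ → ℝ) (n : ℕ) (s : Fin n → ℝ) : ℝ :=
  ∏ i : Fin n, (β (i : ℕ))⁻¹ * Real.exp (-(s i) / β (i : ℕ))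

theorem restrict_pi_Ioi (n : ℕ) :
    (volume : Measure (Fin n → ℝ)).restrict (univ.pi fun _ => Ioi (0 : ℝ)) =
      Measure.pi fun _ => (volume : Measure ℝ).restrict (Ioi 0) := by
  rw [volume_pi, Measure.restrict_pi_pi]

theorem ae_pos_pi_restrict_Ioi (n : ℕ) :
    ∀ᵐ s : Fin n → ℝ ∂(Measure.pi fun _ => (volume : Measure ℝ).restrict (Ioi 0)),
      ∀ i, 0 < s i := by
  rw [← restrict_pi_Ioi]
  filter_upwards [ae_restrict_mem (MeasurableSet.univ_pi fun _ => measurableSet_Ioi)] with s hs i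
  exact hs i (mem_univ i)

theorem rhoFT_eq (β : ℕ → ℝ) (n : ℕ) (x : Fin n → ℝ) :
    rhoFT β n x = ∫ s, (expWeight β n s : ℂ) * gsn n s x
      ∂(Measure.pi fun _ => (volume : Measure ℝ).restrict (Ioi 0)) := by
  rw [← restrict_pi_Ioi]
  rfl

theorem integrable_expWeight_mul_gsn {β : ℕ → ℝ} (hβ : ∀ i, 0 < β i) (n : ℕ) :
    Integrable (fun p : (Fin n → ℝ) × (Fin n → ℝ) => (expWeight β n p.1 : ℂ) * gsn n p.1 p.2)
      ((Measure.pi fun _ => (volume : Measure ℝ).restrict (Ioi 0)).prod volume) := by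
  have hw : Continuous (expWeight β n) := by unfold expWeight; fun_prop
  have hw0 : ∀ s, 0 ≤ expWeight β n s := fun s =>
    Finset.prod_nonneg fun i _ => mul_nonneg (inv_nonneg.2 (hβ i).le) (Real.exp_pos _).le
  have hm : StronglyMeasurable
      fun p : (Fin n → ℝ) × (Fin n → ℝ) => (expWeight β n p.1 : ℂ) * gsn n p.1 p.2 :=
    (by fun_prop : Continuous fun p : (Fin n → ℝ) × (Fin n → ℝ) =>
      (expWeight β n p.1 : ℂ)).stronglyMeasurable.mul (stronglyMeasurable_gsn n)
  refine (integrable_prod_iff hm.aestronglyMeasurable).2 ⟨?_, ?_⟩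
  · filter_upwards [ae_pos_pi_restrict_Ioi n] with s hs
    exact (integrable_gsn_and_integral_norm_le hs).1.const_mul _
  · have hbd : Integrable (fun s : Fin n → ℝ => √n.factorial *
        ∏ i : Fin n, ((β (i : ℕ))⁻¹ * Real.exp (-(s i) / β (i : ℕ)) * √(1 + n / s i)))
        (Measure.pi fun _ => (volume : Measure ℝ).restrict (Ioi 0)) :=
      (Integrable.fintype_prod (f := fun (i : Fin n) (t : ℝ) =>
        (β (i : ℕ))⁻¹ * Real.exp (-t / β (i : ℕ)) * √(1 + n / t))
        fun i => integrableOn_exp_mul_sqrt (hβ i) (Nat.cast_nonneg n)).const_mul _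
    refine hbd.mono' hm.norm.integral_prod_right'.aestronglyMeasurable ?_
    filter_upwards [ae_pos_pi_restrict_Ioi n] with s hs
    rw [Real.norm_of_nonneg (integral_nonneg fun _ => norm_nonneg _)]
    simp only [norm_mul, Complex.norm_real, Real.norm_of_nonneg (hw0 s)]
    rw [integral_const_mul, Finset.prod_mul_distrib, mul_left_comm]
    exact mul_le_mul_of_nonneg_left (integrable_gsn_and_integral_norm_le hs).2 (hw0 s)

theorem setIntegral_rhoFT {β : ℕ → ℝ} (hβ : ∀ i, 0 < β i) (n : ℕ) (E : Set (Fin n → ℝ)) :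
    ∫ x in E, rhoFT β n x = ∫ s, (expWeight β n s : ℂ) * (∫ x in E, gsn n s x)
      ∂(Measure.pi fun _ => (volume : Measure ℝ).restrict (Ioi 0)) := by
  have h := (integrable_expWeight_mul_gsn hβ n).restrict (s := univ ×ˢ E)
  rw [← Measure.prod_restrict, Measure.restrict_univ] at h
  simp_rw [rhoFT_eq, ← integral_const_mul]
  exact (integral_integral_swap h).symm

theorem integral_exp_density {b : ℝ} (hb : 0 < b) :
    ∫ t in Ioi (0 : ℝ), ((b⁻¹ * Real.exp (-t / b) : ℝ) : ℂ) = 1 := by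
  rw [integral_complex_ofReal, integral_const_mul]
  have h : ∀ t : ℝ, -t / b = -b⁻¹ * t := fun t => by ring
  simp_rw [h]
  rw [integral_exp_mul_Ioi (by simpa using hb)]
  simp [hb.ne']

/-- The `ξ`-integral defining `g_{s,n}` converges absolutely, the density
`ρ_n` of the Feynman–Thomas measure `μ^{(n)}` is in `L¹(ℝⁿ)`, and the family `(μ^{(n)})` is
projective: the pushforward of `μ^{(n+1)}` under `(x₁,…,x_{n+1}) ↦ (x₁,…,xₙ)` is `μ^{(n)}`
(equality of the complex measures tested on every measurable set). -/
theorem feynman_thomas_projective (β : ℕ → ℝ) (hβ : ∀ i, 0 < β i) :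
    (∀ n : ℕ, 1 ≤ n → ∀ s ∈ Set.univ.pi (fun _ : Fin n => Ioi (0 : ℝ)), ∀ x : Fin n → ℝ,
      Integrable (fun ξ : Fin n → ℝ =>
        Complex.exp (-(∑ j : Fin n, ∑ k : Fin n, Amat n s j k * (ξ j : ℂ) * (ξ k : ℂ)) / 2
          - Complex.I * (∑ j : Fin n, (ξ j : ℂ) * (x j : ℂ))))) ∧
    (∀ n : ℕ, 1 ≤ n → Integrable (rhoFT β n)) ∧
    (∀ n : ℕ, 1 ≤ n → ∀ E : Set (Fin n → ℝ), MeasurableSet E →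
      ∫ x in (fun (x : Fin (n + 1) → ℝ) (i : Fin n) => x i.castSucc) ⁻¹' E,
          rhoFT β (n + 1) x =
        ∫ x in E, rhoFT β n x) := by
  refine ⟨fun n _ s hs x => integrable_gsnIntegrand n (fun i => hs i (mem_univ i)) x, fun n _ => ?_,
    fun n _ E hE => ?_⟩
  · rw [funext (rhoFT_eq β n)]
    exact (integrable_expWeight_mul_gsn hβ n).integral_prod_right
  · rw [setIntegral_rhoFT hβ, setIntegral_rhoFT hβ]
    have hfac : ∀ (s : Fin n → ℝ) (t : ℝ), (expWeight β (n + 1) (Fin.snoc s t) : ℂ) =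
        (expWeight β n s : ℂ) * (((β n)⁻¹ * Real.exp (-t / β n) : ℝ) : ℂ) := by
      intro s t
      simp [expWeight, Fin.prod_univ_castSucc]
    calc _ = ∫ s, (expWeight β (n + 1) s : ℂ) * (∫ x in E, gsn n (fun i => s i.castSucc) x)
          ∂(Measure.pi fun _ => (volume : Measure ℝ).restrict (Ioi 0)) := by
          refine integral_congr_ae ?_
          filter_upwards [ae_pos_pi_restrict_Ioi (n + 1)] with s hs
          rw [setIntegral_gsn_preimage hs hE]
      _ = _ := by
          rw [← integral_snoc (volume.restrict (Ioi 0)) fun s : Fin (n + 1) → ℝ =>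
            (expWeight β (n + 1) s : ℂ) * (∫ x in E, gsn n (fun i => s i.castSucc) x)]
          refine (integral_congr_ae (ae_of_all _ fun p => ?_)).trans
            ((integral_prod_mul (fun s : Fin n → ℝ => (expWeight β n s : ℂ) *
              (∫ x in E, gsn n s x)) (fun t : ℝ =>
                (((β n)⁻¹ * Real.exp (-t / β n) : ℝ) : ℂ))).trans ?_)
          · simp only [hfac, Fin.snoc_castSucc]
            exact mul_right_comm _ _ _
          · rw [integral_exp_density (hβ n), mul_one]
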